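/- Let S be a set of propositional clauses, let 𝒜 be a collection of alternating paths in S that covers a clause C ∈ S, let C' ∈ S, and let D be a resolvent of C and C' upon a literal L ∈ C. Then there exist a path P ∈ 𝒜 with L ∈ P* and a prefix P' of P (itself an alternating path in S, with the same first clause as P) whose last clause contains L, such that the sequence Γ obtained from P' by appending the pair (L, complement of L) and the clause C' is an alternating path in S, and 𝒜 ∪ {Γ} covers D; moreover the length of Γ is one more than the length of P'. -/

import Mathlib

/-- A propositional literal: an atom together with a Boolean sign. -/
abbrev Lit (α : Type) := α × Bool

/-- A propositional clause: a finite set of literals. -/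
abbrev Clause (α : Type) := Finset (α × Bool)

/-- The complement of a literal flips its sign. -/
def Lit.compl {α : Type} (L : Lit α) : Lit α := (L.1, !L.2)

/-- A valuation satisfies a literal `(a, s)` iff `v a = s`. -/
def SatLit {α : Type} (v : α → Bool) (L : Lit α) : Prop := v L.1 = L.2

/-- A valuation satisfies a clause iff it satisfies some literal of it. -/
def SatClause {α : Type} (v : α → Bool) (C : Clause α) : Prop := ∃ L ∈ C, SatLit v L

/-- A valuation satisfies a set of clauses iff it satisfies every clause in it. -/
def SatSet {α : Type} (v : α → Bool) (S : Set (Clause α)) : Prop := ∀ C ∈ S, SatClause v C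

/-- A set of clauses is satisfiable if some valuation satisfies it. -/
def Satisfiable {α : Type} (S : Set (Clause α)) : Prop := ∃ v, SatSet v S

/-- `IsAltPath S Cs ps` : the sequence of clauses `Cs` together with the list of
linking literal pairs `ps` is an alternating path in `S`.  The path
`C₁,(L₁,M₂),C₂,…,(Lₙ₋₁,Mₙ),Cₙ` is encoded with `Cs = [C₁,…,Cₙ]` and
`ps = [(L₁,M₂),…,(Lₙ₋₁,Mₙ)]`. -/
def IsAltPath {α : Type} [DecidableEq α] (S : Set (Clause α))
    (Cs : List (Clause α)) (ps : List (Lit α × Lit α)) : Prop :=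
  Cs ≠ [] ∧ ps.length + 1 = Cs.length ∧
  (∀ C ∈ Cs, C ∈ S) ∧
  (∀ i, ∀ h : i < ps.length,
    (ps.get ⟨i, h⟩).1 ∈ Cs.getD i ∅ ∧
    (ps.get ⟨i, h⟩).2 ∈ Cs.getD (i + 1) ∅ ∧
    (ps.get ⟨i, h⟩).2 = Lit.compl (ps.get ⟨i, h⟩).1) ∧
  (∀ i, ∀ h : i + 1 < ps.length,
    (ps.get ⟨i + 1, h⟩).1 ≠ (ps.get ⟨i, Nat.lt_of_succ_lt h⟩).2)

/-- There is an alternating path in `S` from `C` to `D` of length `n`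
(length counts the clauses). -/
def AltPathFromTo {α : Type} [DecidableEq α] (S : Set (Clause α))
    (C D : Clause α) (n : ℕ) : Prop :=
  ∃ Cs ps, IsAltPath S Cs ps ∧ Cs.head? = some C ∧ Cs.getLast? = some D ∧ Cs.length = n

/-- The relevance distance `d_S(C, D)`: the minimum length of an alternating path
in `S` from `C` to `D`, or `∞` if there is none. -/
noncomputable def relDist {α : Type} [DecidableEq α] (S : Set (Clause α))
    (C D : Clause α) : ℕ∞ :=
  ⨅ n ∈ {n : ℕ | AltPathFromTo S C D n}, (n : ℕ∞)

/-- `d_S(T, C) = min {d_S(D, C) : D ∈ T}`. -/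
noncomputable def relDistFrom {α : Type} [DecidableEq α] (S T : Set (Clause α))
    (C : Clause α) : ℕ∞ :=
  ⨅ D ∈ T, relDist S D C

/-- `R_{n,S}(T) = {C ∈ S : d_S(T, C) ≤ n}`. -/
def RelSet {α : Type} [DecidableEq α] (n : ℕ) (S T : Set (Clause α)) : Set (Clause α) :=
  {C ∈ S | relDistFrom S T C ≤ (n : ℕ∞)}

/-- A set of clauses is relevance connected if between any two of its clauses
there is an alternating path in it. -/
def RelevanceConnected {α : Type} [DecidableEq α] (S : Set (Clause α)) : Prop :=
  ∀ C ∈ S, ∀ D ∈ S, ∃ n, AltPathFromTo S C D n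

/-- A set of clauses is minimal unsatisfiable if it is unsatisfiable and every
proper subset of it is satisfiable. -/
def MinimalUnsat {α : Type} (S : Set (Clause α)) : Prop :=
  ¬ Satisfiable S ∧ ∀ T ⊂ S, Satisfiable T

/-- `S'` is a support set for `S`: `S' ⊆ S` and every unsatisfiable subset of `S`
meets `S'`. -/
def IsSupport {α : Type} (S S' : Set (Clause α)) : Prop :=
  S' ⊆ S ∧ ∀ T ⊆ S, ¬ Satisfiable T → (T ∩ S').Nonempty

/-- `D` is a resolvent of `C₁` and `C₂` upon literal `L`. -/
def IsResolvent {α : Type} [DecidableEq α] (D C₁ C₂ : Clause α) (L : Lit α) : Prop :=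
  L ∈ C₁ ∧ Lit.compl L ∈ C₂ ∧ D = (C₁.erase L) ∪ (C₂.erase (Lit.compl L))

/-- `Cs` is a resolution sequence from `S`: every clause is an input clause
(member of `S`) or a resolvent of two earlier clauses. -/
def IsResolutionSeq {α : Type} [DecidableEq α] (S : Set (Clause α))
    (Cs : List (Clause α)) : Prop :=
  ∀ i, ∀ h : i < Cs.length,
    Cs.get ⟨i, h⟩ ∈ S ∨
    ∃ j k L, j < i ∧ k < i ∧ IsResolvent (Cs.get ⟨i, h⟩) (Cs.getD j ∅) (Cs.getD k ∅) L

/-- `Cs` is a resolution refutation of length `n` from `S`: a resolution sequence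
of `n` clauses ending in the empty clause. -/
def IsRefutation {α : Type} [DecidableEq α] (S : Set (Clause α))
    (Cs : List (Clause α)) (n : ℕ) : Prop :=
  IsResolutionSeq S Cs ∧ Cs.length = n ∧ Cs.getLast? = some (∅ : Clause α)
/-- The clause contributed to `P*` by the `i`-th clause of the path: the clause
with its exit literal `Lᵢ` (if any) and entry literal `Mᵢ` (if any) removed. -/
def strippedClause {α : Type} [DecidableEq α] (Cs : List (Clause α))
    (ps : List (Lit α × Lit α)) (i : ℕ) : Clause α :=
  (Cs.getD i ∅) \
    (((ps[i]?).map Prod.fst).toFinset ∪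
      ((if i = 0 then none else (ps[i - 1]?).map Prod.snd)).toFinset)

/-- `P*` for an alternating path `P` encoded by `(Cs, ps)`:
`(C₁ \ {L₁}) ∪ ⋃_{1<i<n} (Cᵢ \ {Lᵢ, Mᵢ}) ∪ (Cₙ \ {Mₙ})`; for a one-clause path,
`P* = C₁`. -/
def pathStar {α : Type} [DecidableEq α] (Cs : List (Clause α))
    (ps : List (Lit α × Lit α)) : Clause α :=
  (Finset.range Cs.length).biUnion fun i => strippedClause Cs ps i

/-- A collection `𝒜` of (encoded) alternating paths covers a clause `C` if every
literal of `C` belongs to `P*` for some `P ∈ 𝒜`. -/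
def Covers {α : Type} [DecidableEq α]
    (𝒜 : Set (List (Clause α) × List (Lit α × Lit α))) (C : Clause α) : Prop :=
  ∀ L ∈ C, ∃ P ∈ 𝒜, L ∈ pathStar P.1 P.2

/-- A resolution sequence from `S` with designated parents: `parent i = none`
means clause `i` is an input clause, `parent i = some (j, k, L)` means clause `i`
is a resolvent of the earlier clauses `j` and `k` upon `L`. -/
structure ResSeq (α : Type) [DecidableEq α] (S : Set (Clause α)) where
  clauses : List (Clause α)
  parent : ℕ → Option (ℕ × ℕ × Lit α)
  valid : ∀ i, ∀ h : i < clauses.length,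
    (parent i = none ∧ clauses.get ⟨i, h⟩ ∈ S) ∨
    ∃ j k L, parent i = some (j, k, L) ∧ j < i ∧ k < i ∧
      IsResolvent (clauses.get ⟨i, h⟩) (clauses.getD j ∅) (clauses.getD k ∅) L

/-- Clause `i` of the resolution sequence is `S'`-supported: it is in `S'` or at
least one of its designated parents is `S'`-supported. -/
inductive ResSeq.Supported {α : Type} [DecidableEq α] {S : Set (Clause α)}
    (R : ResSeq α S) (S' : Set (Clause α)) : ℕ → Prop
  | base (i : ℕ) : i < R.clauses.length → R.clauses.getD i ∅ ∈ S' → ResSeq.Supported R S' i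
  | left (i j k : ℕ) (L : Lit α) : R.parent i = some (j, k, L) →
      ResSeq.Supported R S' j → ResSeq.Supported R S' i
  | right (i j k : ℕ) (L : Lit α) : R.parent i = some (j, k, L) →
      ResSeq.Supported R S' k → ResSeq.Supported R S' i

/-- The resolution sequence follows the set of support strategy with support set
`S'`: every derived clause is `S'`-supported. -/
def ResSeq.Strategy {α : Type} [DecidableEq α] {S : Set (Clause α)}
    (R : ResSeq α S) (S' : Set (Clause α)) : Prop :=
  ∀ i, i < R.clauses.length → (R.parent i).isSome → R.Supported S' i

/-- The first `i + 1` clauses of an alternating path, with the links between them, form an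
alternating path. -/
theorem IsAltPath.take {α : Type} [DecidableEq α] {S : Set (Clause α)}
    {Cs : List (Clause α)} {ps : List (Lit α × Lit α)} (h : IsAltPath S Cs ps)
    {i : ℕ} (hi : i < Cs.length) : IsAltPath S (Cs.take (i + 1)) (ps.take i) := by
  obtain ⟨hne, hlen, hmem, hlink, halt⟩ := h
  refine ⟨by simp [hne], by simp; omega, fun C hC => hmem C (List.mem_of_mem_take hC), ?_, ?_⟩
  · intro j hj
    simp only [List.length_take, lt_min_iff] at hj
    have hj' := hlink j hj.2
    have h₁ : (Cs.take (i + 1)).getD j ∅ = Cs.getD j ∅ := by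
      simp [List.getD_eq_getElem?_getD, show j < i + 1 by omega]
    have h₂ : (Cs.take (i + 1)).getD (j + 1) ∅ = Cs.getD (j + 1) ∅ := by
      simp [List.getD_eq_getElem?_getD, hj.1]
    rw [h₁, h₂]
    simpa using hj'
  · intro j hj
    simp only [List.length_take, lt_min_iff] at hj
    simpa using halt j hj.2

/-- An alternating path can be extended along a complementary pair whose first literal lies in
the last clause and is not the literal through which the path entered that clause. -/
theorem IsAltPath.concat {α : Type} [DecidableEq α] {S : Set (Clause α)}
    {Cs : List (Clause α)} {ps : List (Lit α × Lit α)} (h : IsAltPath S Cs ps)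
    {C : Clause α} (hC : C ∈ S) {L : Lit α} (hL : L ∈ Cs.getD ps.length ∅)
    (hcompl : Lit.compl L ∈ C) (hentry : ∀ p ∈ ps.getLast?, L ≠ p.2) :
    IsAltPath S (Cs ++ [C]) (ps ++ [(L, Lit.compl L)]) := by
  obtain ⟨-, hlen, hmem, hlink, halt⟩ := h
  refine ⟨by simp, by simp [hlen], ?_, ?_, ?_⟩
  · intro E hE
    rcases List.mem_append.1 hE with hE | hE
    · exact hmem E hE
    · rwa [List.mem_singleton.1 hE]
  · intro j hj
    simp only [List.length_append, List.length_singleton] at hj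
    have h₁ : (Cs ++ [C]).getD j ∅ = Cs.getD j ∅ := List.getD_append _ _ _ _ (by omega)
    rw [h₁]
    rcases Nat.lt_succ_iff_lt_or_eq.1 hj with hj | rfl
    · have h₂ : (Cs ++ [C]).getD (j + 1) ∅ = Cs.getD (j + 1) ∅ :=
        List.getD_append _ _ _ _ (by omega)
      rw [h₂]
      simpa [List.getElem_append_left hj] using hlink j hj
    · rw [hlen, List.getD_append_right _ _ _ _ le_rfl]
      simpa using ⟨by simpa using hL, hcompl⟩
  · intro j hj
    simp only [List.length_append, List.length_singleton, Nat.add_lt_add_iff_right] at hj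
    by_cases hj' : j + 1 < ps.length
    · simpa [List.getElem_append_left hj', List.getElem_append_left hj] using halt j hj'
    · have hlast : ps.length = j + 1 := by omega
      have := hentry ps[j] (by simp [List.getLast?_eq_getElem?, hlast])
      simpa [List.getElem_append_left hj, List.getElem_append_right, hlast] using this

/-- Every literal of the last clause other than its entry literal belongs to `P*`. -/
theorem mem_pathStar_concat {α : Type} [DecidableEq α] {Cs : List (Clause α)}
    {ps : List (Lit α × Lit α)} (hlen : ps.length + 1 = Cs.length) {C : Clause α}
    {p : Lit α × Lit α} {K : Lit α} (hK : K ∈ C) (hne : K ≠ p.2) :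
    K ∈ pathStar (Cs ++ [C]) (ps ++ [p]) := by
  refine Finset.mem_biUnion.2 ⟨Cs.length, by simp, ?_⟩
  simp [strippedClause, ← hlen, List.getD_eq_getElem?_getD, hK, hne]

/-- If the collection `𝒜` of alternating paths in `S` covers `C ∈ S`, `C' ∈ S`,
and `D` is a resolvent of `C` and `C'` upon `L ∈ C`, then there is a path
`P ∈ 𝒜` with `L ∈ P*` and a prefix `P'` of `P` (itself an alternating path in
`S`, with the same first clause) whose last clause contains `L`, such that `Γ`,
obtained from `P'` by appending the pair `(L, complement of L)` and the clause
`C'`, is an alternating path in `S`, `𝒜 ∪ {Γ}` covers `D`, and the length of `Γ`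
is one more than the length of `P'`. -/
theorem stmt_8 {α : Type} [DecidableEq α] (S : Set (Clause α))
    (𝒜 : Set (List (Clause α) × List (Lit α × Lit α)))
    (h𝒜 : ∀ P ∈ 𝒜, IsAltPath S P.1 P.2)
    (C C' D : Clause α) (hC : C ∈ S) (hC' : C' ∈ S) (hcov : Covers 𝒜 C)
    (L : Lit α) (hres : IsResolvent D C C' L) :
    ∃ P ∈ 𝒜, L ∈ pathStar P.1 P.2 ∧
      ∃ Cs' ps', IsAltPath S Cs' ps' ∧ Cs' <+: P.1 ∧ ps' <+: P.2 ∧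
        Cs'.head? = P.1.head? ∧
        (∃ E, Cs'.getLast? = some E ∧ L ∈ E) ∧
        IsAltPath S (Cs' ++ [C']) (ps' ++ [(L, Lit.compl L)]) ∧
        Covers (𝒜 ∪ {(Cs' ++ [C'], ps' ++ [(L, Lit.compl L)])}) D ∧
        (Cs' ++ [C']).length = Cs'.length + 1 := by
  obtain ⟨hL, hL', rfl⟩ := hres
  obtain ⟨⟨Cs, ps⟩, hP, hLP⟩ := hcov L hL
  have hpath : IsAltPath S Cs ps := h𝒜 _ hP
  refine ⟨(Cs, ps), hP, hLP, ?_⟩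
  obtain ⟨i, hi, hLi⟩ := Finset.mem_biUnion.1 hLP
  replace hi : i < Cs.length := Finset.mem_range.1 hi
  obtain ⟨hLmem, hLnot⟩ := Finset.mem_sdiff.1 hLi
  have hlen : ps.length + 1 = Cs.length := hpath.2.1
  have hips : (ps.take i).length = i := by simp; omega
  have htake : IsAltPath S (Cs.take (i + 1)) (ps.take i) := hpath.take hi
  have hgetD : (Cs.take (i + 1)).getD i ∅ = Cs.getD i ∅ := by
    simp [List.getD_eq_getElem?_getD]
  refine ⟨Cs.take (i + 1), ps.take i, htake, List.take_prefix _ _, List.take_prefix _ _,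
    by simp [List.head?_take], ⟨Cs[i], ?_, ?_⟩, htake.concat hC' ?_ hL' ?_, ?_, by simp⟩
  · simp [List.getLast?_take, hi]
  · simpa [List.getD_eq_getElem?_getD, hi] using hLmem
  · rwa [hips, hgetD]
  · rintro p hp rfl
    apply hLnot
    rcases i with _ | i
    · simp at hp
    · rw [Option.mem_def, List.getLast?_eq_getElem?, hips] at hp
      simp only [Nat.add_sub_cancel, List.getElem?_take, Nat.lt_succ_self, if_true] at hp
      simp [hp]
  · intro K hK
    rcases Finset.mem_union.1 hK with hK | hK
    · obtain ⟨P, hP, hKP⟩ := hcov K (Finset.mem_of_mem_erase hK)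
      exact ⟨P, Or.inl hP, hKP⟩
    · exact ⟨_, Or.inr rfl, mem_pathStar_concat htake.2.1 (Finset.mem_of_mem_erase hK)
        (Finset.ne_of_mem_erase hK)⟩
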